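/- arXiv:2011.12009 — 3 statements merged into one kernel-verified Lean document; each statement's English description precedes it below -/
import Mathlib

section
/- Let Λ be an approximate subgroup of a group G, and let comm(Λ) = {g ∈ G : gΛg⁻¹ is commensurable with Λ} be its commensurator. Then comm(Λ) is equal to the union of all approximate subgroups of G that are commensurable with Λ. In particular: Λ ⊆ comm(Λ); every approximate subgroup of G commensurable with Λ is contained in comm(Λ); and every g ∈ comm(Λ) lies in some approximate subgroup of G commensurable with Λ. -/
open Pointwise

/-- `Λ` is an approximate subgroup of `G`. -/
def IsApproxSubgroup {G : Type*} [Group G] (Λ : Set G) : Prop :=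
  (1 : G) ∈ Λ ∧ Λ⁻¹ = Λ ∧ ∃ F : Finset G, Λ * Λ ⊆ Λ * (F : Set G)

/-- `X` and `Y` are commensurable subsets of the group `G`. -/
def CommensurableSets {G : Type*} [Group G] (X Y : Set G) : Prop :=
  (∃ F : Finset G, X ⊆ Y * (F : Set G)) ∧ ∃ F' : Finset G, Y ⊆ X * (F' : Set G)

/-- The commensurator of `Λ` in `G`: the set of `g ∈ G` such that `gΛg⁻¹` is
commensurable with `Λ`. -/
def Commensurator {G : Type*} [Group G] (Λ : Set G) : Set G :=
  {g : G | CommensurableSets ((fun x => g * x * g⁻¹) '' Λ) Λ}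

/-- `X` is contained in finitely many right translates of `Y`. -/
def FinitelyCovered {G : Type*} [Group G] (X Y : Set G) : Prop :=
  ∃ F : Finset G, X ⊆ Y * (F : Set G)

namespace FinitelyCovered

variable {G : Type*} [Group G] {X Y Z : Set G}

theorem of_subset (h : X ⊆ Y) : FinitelyCovered X Y :=
  ⟨{1}, by simpa using h⟩

theorem trans (h : FinitelyCovered X Y) (h' : FinitelyCovered Y Z) : FinitelyCovered X Z := by
  classical
  obtain ⟨F, hF⟩ := h
  obtain ⟨F', hF'⟩ := h'
  refine ⟨F' * F, hF.trans ?_⟩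
  rw [Finset.coe_mul, ← mul_assoc]
  exact Set.mul_subset_mul_right hF'

theorem union (h : FinitelyCovered X Z) (h' : FinitelyCovered Y Z) :
    FinitelyCovered (X ∪ Y) Z := by
  classical
  obtain ⟨F, hF⟩ := h
  obtain ⟨F', hF'⟩ := h'
  refine ⟨F ∪ F', ?_⟩
  rw [Finset.coe_union, Set.mul_union]
  exact Set.union_subset_union hF hF'

theorem smul (g : G) (h : FinitelyCovered X Y) : FinitelyCovered (g • X) (g • Y) := by
  obtain ⟨F, hF⟩ := h
  refine ⟨F, ?_⟩
  rw [smul_mul_assoc]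
  exact Set.smul_set_mono hF

theorem mul_finite_self (X : Set G) {S : Set G} (hS : S.Finite) : FinitelyCovered (X * S) X :=
  ⟨hS.toFinset, by simp⟩

theorem of_finite (hX : X.Finite) (hY : (1 : G) ∈ Y) : FinitelyCovered X Y :=
  (of_subset (Set.subset_mul_right X hY)).trans (mul_finite_self Y hX)

end FinitelyCovered

theorem image_conj_eq_smul_mul {G : Type*} [Group G] (g : G) (X : Set G) :
    (fun x => g * x * g⁻¹) '' X = g • X * {g⁻¹} := by
  rw [Set.mul_singleton, ← Set.image_smul, Set.image_image]
  rfl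

theorem mem_commensurator_iff {G : Type*} [Group G] {X : Set G} {g : G} :
    g ∈ Commensurator X ↔ FinitelyCovered (g • X) X ∧ FinitelyCovered X (g • X) := by
  have h₁ : FinitelyCovered (g • X * {g⁻¹}) (g • X) :=
    .mul_finite_self _ (Set.finite_singleton _)
  have h₂ : FinitelyCovered (g • X) (g • X * {g⁻¹}) :=
    ⟨{g}, by rw [Finset.coe_singleton, mul_assoc, Set.singleton_mul_singleton]; simp⟩
  change FinitelyCovered _ X ∧ FinitelyCovered X _ ↔ _
  rw [image_conj_eq_smul_mul]
  exact ⟨fun h => ⟨h₂.trans h.1, h.2.trans h₁⟩, fun h => ⟨h₁.trans h.1, h.2.trans h₂⟩⟩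

theorem CommensurableSets.commensurator_subset {G : Type*} [Group G] {X Y : Set G}
    (h : CommensurableSets X Y) : Commensurator X ⊆ Commensurator Y := by
  intro g hg
  rw [mem_commensurator_iff] at hg ⊢
  have hXY : FinitelyCovered X Y := h.1
  have hYX : FinitelyCovered Y X := h.2
  exact ⟨((hYX.smul g).trans hg.1).trans hXY, (hYX.trans hg.2).trans (hXY.smul g)⟩

theorem IsApproxSubgroup.subset_commensurator {G : Type*} [Group G] {X : Set G}
    (hX : IsApproxSubgroup X) : X ⊆ Commensurator X := by
  have key : ∀ g ∈ X, FinitelyCovered (g • X) X := fun g hg =>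
    (FinitelyCovered.of_subset (Set.smul_set_subset_mul hg)).trans hX.2.2
  intro g hg
  have hg' : g⁻¹ ∈ X := Set.mem_inv.1 (hX.2.1.symm ▸ hg)
  exact mem_commensurator_iff.2 ⟨key g hg, by simpa using (key g⁻¹ hg').smul g⟩

theorem IsApproxSubgroup.union_pair {G : Type*} [Group G] {X : Set G}
    (hX : IsApproxSubgroup X) {g : G} (hg : g ∈ Commensurator X) :
    IsApproxSubgroup (X ∪ {g, g⁻¹}) ∧ CommensurableSets (X ∪ {g, g⁻¹}) X := by
  obtain ⟨h₁, h₂⟩ := mem_commensurator_iff.1 hg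
  have h₂' : FinitelyCovered (g⁻¹ • X) X := by simpa using h₂.smul g⁻¹
  have hfin : ({g, g⁻¹} : Set G).Finite := Set.toFinite _
  have hsub : FinitelyCovered X (X ∪ {g, g⁻¹}) := .of_subset Set.subset_union_left
  have hpair : FinitelyCovered ({g, g⁻¹} * X) X := by
    rw [Set.insert_eq, Set.union_mul, Set.singleton_mul, Set.singleton_mul]
    exact h₁.union h₂'
  have hmul : FinitelyCovered ((X ∪ {g, g⁻¹}) * (X ∪ {g, g⁻¹})) X := by
    rw [Set.union_mul, Set.mul_union, Set.mul_union]
    exact (FinitelyCovered.union hX.2.2 (.mul_finite_self X hfin)).union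
      (hpair.union (.of_finite (hfin.mul hfin) hX.1))
  refine ⟨⟨.inl hX.1, ?_, hmul.trans hsub⟩,
    (FinitelyCovered.of_subset subset_rfl).union (.of_finite hfin hX.1), hsub⟩
  rw [Set.union_inv, hX.2.1, Set.inv_insert, Set.inv_singleton, inv_inv, Set.pair_comm]

/-- **Lemma.**  For an approximate subgroup `Λ` of `G`, the commensurator of `Λ` equals
the union of all approximate subgroups of `G` commensurable with `Λ`.  In particular `Λ`
is contained in its commensurator, every approximate subgroup commensurable with `Λ` is
contained in the commensurator, and every element of the commensurator lies in some
approximate subgroup commensurable with `Λ`. -/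
theorem commensurator_eq_union_of_commensurable_approx_subgroups
    {G : Type*} [Group G] (Λ : Set G) (hΛ : IsApproxSubgroup Λ) :
    Commensurator Λ = ⋃₀ {X : Set G | IsApproxSubgroup X ∧ CommensurableSets X Λ} ∧
    Λ ⊆ Commensurator Λ ∧
    (∀ X : Set G, IsApproxSubgroup X → CommensurableSets X Λ → X ⊆ Commensurator Λ) ∧
    ∀ g ∈ Commensurator Λ,
      ∃ X : Set G, IsApproxSubgroup X ∧ CommensurableSets X Λ ∧ g ∈ X := by
  have hsub : ∀ X : Set G, IsApproxSubgroup X → CommensurableSets X Λ → X ⊆ Commensurator Λ :=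
    fun X hX h => hX.subset_commensurator.trans h.commensurator_subset
  have hex : ∀ g ∈ Commensurator Λ,
      ∃ X : Set G, IsApproxSubgroup X ∧ CommensurableSets X Λ ∧ g ∈ X := fun g hg =>
    ⟨Λ ∪ {g, g⁻¹}, (hΛ.union_pair hg).1, (hΛ.union_pair hg).2, by simp⟩
  refine ⟨Set.Subset.antisymm (fun g hg => ?_) (Set.sUnion_subset fun X hX => hsub X hX.1 hX.2),
    hΛ.subset_commensurator, hsub, hex⟩
  obtain ⟨X, hX, hXΛ, hgX⟩ := hex g hg
  exact ⟨X, ⟨hX, hXΛ⟩, hgX⟩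
end

section
/- Let G and H be groups, K ⊆ H a subset with 1 ∈ K = K⁻¹ and hKh⁻¹ = K for all h ∈ H, and f : G → H a map with f(1) = 1 and f(xy) ∈ f(x)·f(y)·K for all x, y ∈ G. Let H₂ ≤ H be a subgroup and m ≥ 1 such that H₂·K^m = H. Then there exists a map g : G → H₂ with g(1) = 1, g(x) ∈ f(x)·K^m for all x ∈ G, and g(xy) ∈ g(x)·g(y)·(K^{3m+1} ∩ H₂) for all x, y ∈ G; moreover for every subset U ⊆ H one has f⁻¹(U) ⊆ g⁻¹(U·K^m ∩ H₂) ⊆ f⁻¹(U·K^{2m}). -/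
open Pointwise

theorem Set.conj_mem_pow {H : Type*} [Group H] {K : Set H}
    (hK : ∀ h : H, (fun x => h * x * h⁻¹) '' K = K) (n : ℕ) (h : H) {k : H}
    (hk : k ∈ K ^ n) : h * k * h⁻¹ ∈ K ^ n := by
  have himage : (MulAut.conj h) '' (K ^ n) = K ^ n := by
    rw [Set.image_pow]
    exact congrArg (· ^ n) (hK h)
  rw [← himage]
  exact ⟨k, hk, rfl⟩

/-- **Lemma (moving a quasi-homomorphism into a subgroup covering the target).**
Let `f : G → H : K` be a quasi-homomorphism with `1 ∈ K = K⁻¹` and `K` normal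
(conjugation-invariant) in `H`.  Let `H₂ ≤ H` and `m ≥ 1` with `H₂·K^m = H`.  Then there
is a map `g : G → H` taking values in `H₂`, with `g 1 = 1`, `g x ∈ f x · K^m`,
`g (xy) ∈ g x · g y · (K^{3m+1} ∩ H₂)`, and for every `U ⊆ H`,
`f⁻¹(U) ⊆ g⁻¹(U·K^m ∩ H₂) ⊆ f⁻¹(U·K^{2m})`. -/
theorem quasi_hom_into_covering_subgroup
    {G H : Type*} [Group G] [Group H]
    (K : Set H) (hK1 : (1 : H) ∈ K) (hKs : K⁻¹ = K)
    (hKn : ∀ h : H, (fun x => h * x * h⁻¹) '' K = K)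
    (f : G → H) (hf1 : f 1 = 1)
    (hf : ∀ x y : G, ∃ k ∈ K, f (x * y) = f x * f y * k)
    (H₂ : Subgroup H) (m : ℕ) (hm : 1 ≤ m)
    (hcover : (H₂ : Set H) * K ^ m = Set.univ) :
    ∃ g : G → H,
      (∀ x : G, g x ∈ H₂) ∧ g 1 = 1 ∧
      (∀ x : G, ∃ k ∈ K ^ m, g x = f x * k) ∧
      (∀ x y : G, ∃ k ∈ K ^ (3 * m + 1) ∩ (H₂ : Set H), g (x * y) = g x * g y * k) ∧
      ∀ U : Set H,
        f ⁻¹' U ⊆ g ⁻¹' (U * K ^ m ∩ (H₂ : Set H)) ∧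
        g ⁻¹' (U * K ^ m ∩ (H₂ : Set H)) ⊆ f ⁻¹' (U * K ^ (2 * m)) := by
  have hinv : ∀ {k : H}, k ∈ K ^ m → k⁻¹ ∈ K ^ m := by
    intro k hk
    rwa [← Set.mem_inv, ← inv_pow, hKs]
  have hex : ∀ x : G, ∃ h ∈ H₂, (∃ k ∈ K ^ m, h = f x * k) ∧ (x = 1 → h = 1) := by
    intro x
    by_cases hx : x = 1
    · exact ⟨1, H₂.one_mem, ⟨1, Set.one_mem_pow hK1, by simp [hx, hf1]⟩, fun _ => rfl⟩
    · obtain ⟨h, hh, k, hk, hfx⟩ := Set.mem_mul.mp (hcover ▸ Set.mem_univ (f x))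
      exact ⟨h, hh, ⟨k⁻¹, hinv hk, by simp [← hfx]⟩, fun h1 => absurd h1 hx⟩
  choose g hgH hgf hg1 using hex
  refine ⟨g, hgH, hg1 1 rfl, hgf, fun x y => ?_, fun U => ⟨fun x hx => ?_, ?_⟩⟩
  · refine ⟨(g x * g y)⁻¹ * g (x * y), ⟨?_, ?_⟩, by group⟩
    · obtain ⟨a, ha, hgx⟩ := hgf x
      obtain ⟨b, hb, hgy⟩ := hgf y
      obtain ⟨c, hc, hgxy⟩ := hgf (x * y)
      obtain ⟨k, hk, hfxy⟩ := hf x y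
      have hconj := Set.conj_mem_pow hKn m (f y)⁻¹ (hinv ha)
      have hprod := Set.mul_mem_mul
        (Set.mul_mem_mul (Set.mul_mem_mul (hinv hb) hconj) (by rwa [pow_one] : k ∈ K ^ 1)) hc
      rw [← pow_add, ← pow_add, ← pow_add] at hprod
      rw [show 3 * m + 1 = m + m + 1 + m by ring]
      convert hprod using 1
      rw [hgxy, hgx, hgy, hfxy]
      group
    · exact H₂.mul_mem (H₂.inv_mem (H₂.mul_mem (hgH x) (hgH y))) (hgH (x * y))
  · obtain ⟨k, hk, hgx⟩ := hgf x
    exact ⟨Set.mem_mul.mpr ⟨f x, hx, k, hk, hgx.symm⟩, hgH x⟩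
  · rintro x ⟨⟨u, hu, a, ha, hua⟩, -⟩
    obtain ⟨k, hk, hgx⟩ := hgf x
    refine Set.mem_mul.mpr ⟨u, hu, a * k⁻¹, ?_, ?_⟩
    · rw [two_mul, pow_add]
      exact Set.mul_mem_mul ha (hinv hk)
    · rw [← mul_assoc, mul_inv_eq_iff_eq_mul, ← hgx]
      exact hua
end

section
/- Let G be a group admitting a left-invariant finitely additive probability measure defined on all subsets of G, i.e. a function μ : 𝒫(G) → [0,1] with μ(G) = 1, μ(A ∪ B) = μ(A) + μ(B) for disjoint A, B ⊆ G, and μ(gA) = μ(A) for all g ∈ G and A ⊆ G. Let Λ be an approximate subgroup of G. Then there exists a finitely additive measure ν defined on all subsets of Λ³ with 0 < ν(Λ), ν(Λ³) < ∞, and ν(Y) = ν(aY) whenever a ∈ G, Y ⊆ Λ³ and aY ⊆ Λ³. -/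
open Pointwise
open scoped ENNReal

/-- Every relation admits a maximal pairwise-related set. -/
theorem exists_maximal_pairwise {α : Type*} (r : α → α → Prop) :
    ∃ X : Set α, Maximal (fun X : Set α => X.Pairwise r) X := by
  refine zorn_subset {X : Set α | X.Pairwise r} fun c hc hchain => ?_
  exact ⟨⋃₀ c, (Set.pairwise_sUnion hchain.directedOn).2 hc,
    fun s hs => Set.subset_sUnion_of_mem hs⟩

/-- A maximal set `X` whose translates `S * {x}` are disjoint satisfies `S⁻¹ * S * X = G`. -/
theorem exists_disjoint_translates_covering {G : Type*} [Group G] {S : Set G}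
    (hS : S.Nonempty) :
    ∃ X : Set G, (∀ p ∈ S, ∀ q ∈ S, ∀ x ∈ X, ∀ y ∈ X, p * x = q * y → x = y) ∧
      S⁻¹ * S * X = Set.univ := by
  obtain ⟨X, hX⟩ := exists_maximal_pairwise
    (fun x y : G => ∀ p ∈ S, ∀ q ∈ S, p * x ≠ q * y)
  refine ⟨X, fun p hp q hq x hx y hy h => ?_, Set.eq_univ_of_forall fun g => ?_⟩
  · by_contra hne
    exact hX.prop hx hy hne p hp q hq h
  · by_contra hg
    have key : ∀ x ∈ X, ∀ p ∈ S, ∀ q ∈ S, p * g ≠ q * x := by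
      intro x hx p hp q hq h
      refine hg ⟨p⁻¹ * q, ⟨p⁻¹, Set.inv_mem_inv.2 hp, q, hq, rfl⟩, x, hx, ?_⟩
      simp [mul_assoc, ← h]
    have hins : (insert g X).Pairwise (fun x y : G => ∀ p ∈ S, ∀ q ∈ S, p * x ≠ q * y) :=
      hX.prop.insert fun x hx _ =>
        ⟨key x hx, fun p hp q hq h => key x hx q hq p hp h.symm⟩
    have hgX : g ∈ X := hX.le_of_ge hins (Set.subset_insert g X) (Set.mem_insert g X)
    obtain ⟨s, hs⟩ := hS
    exact key g hgX s hs s hs rfl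

/-- All powers of an approximate subgroup are covered by finitely many left translates. -/
theorem IsApproxSubgroup.exists_finite_pow_subset {G : Type*} [Group G] {Λ : Set G}
    (hΛ : IsApproxSubgroup Λ) (n : ℕ) :
    ∃ E : Set G, E.Finite ∧ Λ ^ (n + 1) ⊆ E * Λ := by
  obtain ⟨-, hsymm, F, hF⟩ := hΛ
  have hleft : Λ * Λ ⊆ (F : Set G)⁻¹ * Λ := by
    have h := Set.inv_subset_inv.2 hF
    rwa [mul_inv_rev, mul_inv_rev, hsymm] at h
  induction n with
  | zero => exact ⟨1, Set.finite_one, by simp⟩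
  | succ n ih =>
    obtain ⟨E, hE, hsub⟩ := ih
    refine ⟨E * (F : Set G)⁻¹, hE.mul F.finite_toSet.inv, ?_⟩
    calc Λ ^ (n + 1 + 1) = Λ ^ (n + 1) * Λ := pow_succ _ _
      _ ⊆ E * Λ * Λ := Set.mul_subset_mul_right hsub
      _ = E * (Λ * Λ) := mul_assoc _ _ _
      _ ⊆ E * ((F : Set G)⁻¹ * Λ) := Set.mul_subset_mul_left hleft
      _ = E * (F : Set G)⁻¹ * Λ := (mul_assoc _ _ _).symm

/-- A nonnegative finitely additive set function is monotone. -/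
theorem le_of_subset_of_finitely_additive {α : Type*} {μ : Set α → ℝ} (hμ0 : ∀ A, 0 ≤ μ A)
    (hadd : ∀ A B : Set α, Disjoint A B → μ (A ∪ B) = μ A + μ B) {A B : Set α} (h : A ⊆ B) :
    μ A ≤ μ B := by
  have := hadd A (B \ A) Set.disjoint_sdiff_right
  rw [Set.union_sdiff_cancel h] at this
  linarith [hμ0 (B \ A)]

/-- Finitely many left translates of a null set form a null set. -/
theorem finite_mul_null {G : Type*} [Group G] {μ : Set G → ℝ} (hμ0 : ∀ A, 0 ≤ μ A)
    (hadd : ∀ A B : Set G, Disjoint A B → μ (A ∪ B) = μ A + μ B)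
    (hinv : ∀ (g : G) (A : Set G), μ ((fun x => g * x) '' A) = μ A)
    {E T : Set G} (hE : E.Finite) (hT : μ T = 0) : μ (E * T) = 0 := by
  induction E, hE using Set.Finite.induction_on with
  | empty =>
    have := hadd ∅ ∅ (Set.disjoint_empty _)
    rw [Set.union_self] at this
    rw [Set.empty_mul]
    linarith
  | @insert a s _ _ ih =>
    have hunion : insert a s * T = s * T ∪ ((fun x => a * x) '' T) \ (s * T) := by
      rw [Set.union_sdiff_self, Set.insert_eq, Set.union_mul, Set.singleton_mul, Set.union_comm]
    have hle : μ (((fun x => a * x) '' T) \ (s * T)) ≤ μ ((fun x => a * x) '' T) :=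
      le_of_subset_of_finitely_additive hμ0 hadd Set.sdiff_subset
    rw [hinv, hT] at hle
    rw [hunion, hadd _ _ Set.disjoint_sdiff_right, ih, zero_add]
    exact le_antisymm hle (hμ0 _)

/-- **Lemma (amenability passes to approximate subgroups).**  Let `G` be a group carrying
a left-invariant finitely additive probability measure `μ` defined on all subsets, and
let `Λ` be an approximate subgroup of `G`.  Then there is a finitely additive measure `ν`
on all subsets of `Λ³` with `0 < ν(Λ)`, `ν(Λ³) < ∞`, invariant under left translations
that stay inside `Λ³`. -/
theorem amenable_group_approx_subgroup_amenable
    {G : Type*} [Group G]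
    (μ : Set G → ℝ) (hμ0 : ∀ A : Set G, 0 ≤ μ A) (hμle : ∀ A : Set G, μ A ≤ 1)
    (hμ1 : μ Set.univ = 1)
    (hadd : ∀ A B : Set G, Disjoint A B → μ (A ∪ B) = μ A + μ B)
    (hinv : ∀ (g : G) (A : Set G), μ ((fun x => g * x) '' A) = μ A)
    (Λ : Set G) (hΛ : IsApproxSubgroup Λ) :
    ∃ ν : Set G → ℝ≥0∞,
      0 < ν Λ ∧ ν (Λ ^ 3) < ⊤ ∧
      (∀ A B : Set G, A ⊆ Λ ^ 3 → B ⊆ Λ ^ 3 → Disjoint A B → ν (A ∪ B) = ν A + ν B) ∧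
      ∀ (a : G) (Y : Set G), Y ⊆ Λ ^ 3 → (fun x => a * x) '' Y ⊆ Λ ^ 3 →
        ν ((fun x => a * x) '' Y) = ν Y := by
  obtain ⟨X, hX, hcov⟩ := exists_disjoint_translates_covering
    (S := Λ ^ 3) ⟨1, Set.one_mem_pow hΛ.1⟩
  obtain ⟨E, hE, hsub⟩ := hΛ.exists_finite_pow_subset 5
  refine ⟨fun Y => ENNReal.ofReal (μ (Y * X)), ENNReal.ofReal_pos.2 ?_, ENNReal.ofReal_lt_top,
    fun A B hA hB hAB => ?_, fun a Y _ _ => ?_⟩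
  · refine (hμ0 _).lt_of_ne' fun h0 => ?_
    have hnull := finite_mul_null hμ0 hadd hinv hE h0
    have huniv : E * (Λ * X) = Set.univ := by
      rw [← inv_pow, hΛ.2.1, ← pow_add] at hcov
      rw [← mul_assoc]
      exact Set.univ_subset_iff.1 (hcov ▸ Set.mul_subset_mul_right hsub)
    rw [huniv, hμ1] at hnull
    exact one_ne_zero hnull
  · have hdisj : Disjoint (A * X) (B * X) := by
      rw [Set.disjoint_left]
      rintro _ ⟨p, hp, x, hx, rfl⟩ ⟨q, hq, y, hy, h⟩
      have h' : q * y = p * x := h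
      obtain rfl := hX q (hB hq) p (hA hp) y hy x hx h'
      obtain rfl := mul_right_cancel h'
      exact Set.disjoint_left.1 hAB hp hq
    beta_reduce
    rw [Set.union_mul, hadd _ _ hdisj, ENNReal.ofReal_add (hμ0 _) (hμ0 _)]
  · have himage : (fun x => a * x) '' Y * X = (fun x => a * x) '' (Y * X) := by
      rw [← Set.singleton_mul, ← Set.singleton_mul, mul_assoc]
    beta_reduce
    rw [himage, hinv]
end
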